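/- Let $\sigma: \mathbb{R} \to \mathbb{R}$ be continuous and let $F: \mathbb{R}^{d_{in}} \to \mathbb{R}^{d_{out}}$ be a neural network function $F(x) = W_L(A_{L-1} \circ \cdots \circ A_1(x)) + b_L$, where $A_j(x) = \sigma(W_j x + b_j)$, $W_j \in \mathbb{R}^{d_j \times d_{j-1}}$, $b_j \in \mathbb{R}^{d_j}$, with width $\omega_F = \max\{d_j : j = 1, \dots, L\} \le d_{in}$. Then for every compact set $K \subset \mathbb{R}^{d_{in}}$ and every $\varepsilon > 0$ there exist invertible matrices $\tilde{W}_1, \dots, \tilde{W}_{L-1} \in \mathbb{R}^{d_{in}\times d_{in}}$ and vectors $\tilde{b}_1, \dots, \tilde{b}_{L-1} \in \mathbb{R}^{d_{in}}$ (obtained by padding the original $W_j$ with zero rows and columns and the $b_j$ with zero components) such that the network function $\tilde{F}(x) = W_L'(\tilde{A}_{L-1} \circ \cdots \circ \tilde{A}_1(x)) + b_L$ with $\tilde{A}_j(x) = \sigma(\tilde{W}_j x + \tilde{b}_j)$, where $W_L'$ is the padded final weight matrix, satisfies $\lVert \tilde{F} - F \rVert_K < \varepsilon$. -/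

import Mathlib

/-- The Euclidean norm of a vector in `ℝ^d`. -/
noncomputable def euclNorm {d : ℕ} (v : Fin d → ℝ) : ℝ :=
  Real.sqrt (∑ i, v i ^ 2)

/-- The sup-norm `‖f‖_D = sup {‖f x‖ : x ∈ D}` of a vector-valued map over a set. -/
noncomputable def supNormOn {d m : ℕ} (f : (Fin d → ℝ) → Fin m → ℝ)
    (D : Set (Fin d → ℝ)) : ℝ :=
  sSup {r | ∃ x ∈ D, r = euclNorm (f x)}

/-- The composition `A_j ∘ ⋯ ∘ A_1` of the first `j` layers
`A_k(x) = σ(W_k x + b_k)` of a network with layer widths `d 0, d 1, …`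
(`σ` applied componentwise); layer `k` uses `W (k-1)` and `b (k-1)`. -/
def hiddenStack (σ : ℝ → ℝ) (d : ℕ → ℕ)
    (W : (j : ℕ) → Matrix (Fin (d (j + 1))) (Fin (d j)) ℝ)
    (b : (j : ℕ) → Fin (d (j + 1)) → ℝ) :
    (j : ℕ) → (Fin (d 0) → ℝ) → Fin (d j) → ℝ
  | 0, x => x
  | j + 1, x => fun i => σ ((W j).mulVec (hiddenStack σ d W b j x) i + b j i)

/-- The composition of `j` square layers of width `d`. -/
def sqStack (σ : ℝ → ℝ) {d : ℕ} (W : ℕ → Matrix (Fin d) (Fin d) ℝ)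
    (b : ℕ → Fin d → ℝ) : ℕ → (Fin d → ℝ) → Fin d → ℝ
  | 0, x => x
  | j + 1, x => fun i => σ ((W j).mulVec (sqStack σ W b j x) i + b j i)

/-- Padding a vector in `ℝ^m` with zero components to a vector in `ℝ^n`. -/
def padVec {m n : ℕ} (v : Fin m → ℝ) : Fin n → ℝ :=
  fun i => if h : (i : ℕ) < m then v ⟨i, h⟩ else 0

/-- Padding a matrix with zero columns. -/
def padCols {k m n : ℕ} (M : Matrix (Fin k) (Fin m) ℝ) : Matrix (Fin k) (Fin n) ℝ :=
  fun i j => if h : (j : ℕ) < m then M i ⟨j, h⟩ else 0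

open Filter Topology in
/-- Shifting a square matrix by a small nonzero multiple of the identity makes it invertible. -/
theorem eventually_isUnit_det_add_smul_one {n : ℕ} (A : Matrix (Fin n) (Fin n) ℝ) :
    ∀ᶠ t : ℝ in 𝓝[≠] 0, IsUnit (A + t • (1 : Matrix (Fin n) (Fin n) ℝ)).det := by
  have hfin : {t : ℝ | (-A).charpoly.IsRoot t}.Finite :=
    Polynomial.finite_setOfPred_isRoot (Matrix.charpoly_monic _).ne_zero
  filter_upwards [nhdsNE_le_cofinite 0 hfin.compl_mem_cofinite] with t ht
  rw [isUnit_iff_ne_zero]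
  intro h
  refine ht ?_
  change Polynomial.eval t _ = 0
  rw [Matrix.eval_charpoly, ← h, sub_neg_eq_add, add_comm, Matrix.smul_one_eq_diagonal]
  rfl

/-- Padding a matrix with zero rows and zero columns. -/
def padMat {k m n : ℕ} (M : Matrix (Fin k) (Fin m) ℝ) : Matrix (Fin n) (Fin n) ℝ :=
  fun i j => if h : (i : ℕ) < k then padCols M ⟨i, h⟩ j else 0

theorem padCols_mulVec {k m n : ℕ} (hmn : m ≤ n) (M : Matrix (Fin k) (Fin m) ℝ)
    (v : Fin n → ℝ) :
    (padCols M).mulVec v = M.mulVec fun i => v (Fin.castLE hmn i) := by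
  obtain ⟨p, rfl⟩ := Nat.exists_eq_add_of_le hmn
  ext i
  simp only [Matrix.mulVec, dotProduct, padCols, Fin.sum_univ_add]
  simp [Fin.castAdd]

theorem sqStack_padMat_castLE (σ : ℝ → ℝ) (d : ℕ → ℕ) (L : ℕ)
    (W : (j : ℕ) → Matrix (Fin (d (j + 1))) (Fin (d j)) ℝ)
    (b : (j : ℕ) → Fin (d (j + 1)) → ℝ) (hd : ∀ j ≤ L, d j ≤ d 0) (x : Fin (d 0) → ℝ) :
    ∀ j (hj : j ≤ L), (fun i => sqStack σ (fun j => padMat (W j)) (fun j => padVec (b j)) j x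
      (Fin.castLE (hd j hj) i)) = hiddenStack σ d W b j x
  | 0, _ => rfl
  | j + 1, hj => by
    have ih := sqStack_padMat_castLE σ d L W b hd x j (by omega)
    ext i
    simp only [sqStack, hiddenStack]
    rw [← ih, ← padCols_mulVec]
    simp [Matrix.mulVec, padMat, padVec]

theorem continuous_sqStack {X : Type*} [TopologicalSpace X] {σ : ℝ → ℝ} (hσ : Continuous σ)
    {n : ℕ} {W : X → ℕ → Matrix (Fin n) (Fin n) ℝ} (hW : ∀ j, Continuous fun p => W p j)
    (b : ℕ → Fin n → ℝ) {x : X → Fin n → ℝ} (hx : Continuous x) (j : ℕ) :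
    Continuous fun p => sqStack σ (W p) b j (x p) := by
  induction j with
  | zero => exact hx
  | succ j ih =>
    refine continuous_pi fun i => hσ.comp (Continuous.add ?_ continuous_const)
    exact (continuous_apply i).comp ((hW j).matrix_mulVec ih)

theorem continuous_euclNorm {n : ℕ} : Continuous (euclNorm : (Fin n → ℝ) → ℝ) := by
  unfold euclNorm
  fun_prop

open Topology in
/-- Proposition 5: a network `F(x) = W_L(A_{L-1} ∘ ⋯ ∘ A_1(x)) + b_L` of depth
`L+1` whose width does not exceed the input dimension `d 0` can be approximated
uniformly on any compact `K`, to any accuracy `ε > 0`, by a network `F̃` whose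
hidden layers are square `d 0 × d 0` layers with invertible weight matrices,
whose hidden biases are the original biases padded with zero components, and
whose final weight matrix is the original one padded with zero columns. -/
theorem approx_narrow_network_by_invertible_square_layers
    (σ : ℝ → ℝ) (hσ : Continuous σ)
    (d : ℕ → ℕ) (L : ℕ)
    (W : (j : ℕ) → Matrix (Fin (d (j + 1))) (Fin (d j)) ℝ)
    (b : (j : ℕ) → Fin (d (j + 1)) → ℝ)
    (hwidth : ∀ j, 1 ≤ j → j ≤ L + 1 → d j ≤ d 0)
    (F : (Fin (d 0) → ℝ) → Fin (d (L + 1)) → ℝ)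
    (hF : ∀ x, F x = (W L).mulVec (hiddenStack σ d W b L x) + b L)
    (K : Set (Fin (d 0) → ℝ)) (hK : IsCompact K)
    (ε : ℝ) (hε : 0 < ε) :
    ∃ Wt : ℕ → Matrix (Fin (d 0)) (Fin (d 0)) ℝ,
      (∀ j < L, IsUnit (Wt j).det) ∧
      supNormOn
        (fun x =>
          ((padCols (W L)).mulVec (sqStack σ Wt (fun j => padVec (b j)) L x) + b L)
            - F x) K < ε := by
  have hd : ∀ j ≤ L, d j ≤ d 0 := fun j hj => by
    rcases Nat.eq_zero_or_pos j with rfl | h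
    · exact le_rfl
    · exact hwidth j h (by omega)
  let V : ℝ → ℕ → Matrix (Fin (d 0)) (Fin (d 0)) ℝ := fun t j => padMat (W j) + t • 1
  let G : (Fin (d 0) → ℝ) → ℝ → Fin (d (L + 1)) → ℝ := fun x t =>
    (padCols (W L)).mulVec (sqStack σ (V t) (fun j => padVec (b j)) L x) + b L
  have hG0 : ∀ x, G x 0 = F x := fun x => by
    have hV : V 0 = fun j => padMat (W j) := by simp [V]
    simp only [G, hV, hF]
    rw [padCols_mulVec (hd L le_rfl), sqStack_padMat_castLE σ d L W b hd x L le_rfl]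
  have hG : Continuous fun p : (Fin (d 0) → ℝ) × ℝ => G p.1 p.2 := by
    refine Continuous.add (Continuous.matrix_mulVec continuous_const
      (continuous_sqStack hσ (fun j => ?_) _ continuous_fst L)) continuous_const
    exact continuous_const.add (continuous_snd.smul continuous_const)
  have hFc : Continuous F := by
    simpa [Function.comp_def, hG0] using
      hG.comp (continuous_id.prodMk (continuous_const (y := (0 : ℝ))))
  have hnear : ∀ᶠ t in 𝓝 (0 : ℝ), ∀ x ∈ K, euclNorm (G x t - F x) < ε / 2 := by
    refine hK.eventually_forall_of_forall_eventually fun x _ => ?_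
    have hc : Continuous fun p : ℝ × (Fin (d 0) → ℝ) => euclNorm (G p.2 p.1 - F p.2) :=
      continuous_euclNorm.comp ((hG.comp continuous_swap).sub (hFc.comp continuous_snd))
    refine hc.continuousAt.eventually_lt continuousAt_const ?_
    simpa [hG0, euclNorm] using hε
  have hunit : ∀ᶠ t in 𝓝[≠] (0 : ℝ), ∀ j ∈ Finset.range L, IsUnit (V t j).det :=
    (Filter.eventually_all_finset _).2 fun j _ => eventually_isUnit_det_add_smul_one _
  obtain ⟨t, ht, htK⟩ := (hunit.and (hnear.filter_mono nhdsWithin_le_nhds)).exists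
  refine ⟨V t, fun j hj => ht j (Finset.mem_range.2 hj),
    (Real.sSup_le ?_ (half_pos hε).le).trans_lt (half_lt_self hε)⟩
  rintro r ⟨x, hx, rfl⟩
  exact (htK x hx).le
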